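/- Suppose n = 4 and one of the following holds: (i) q_{(123)}(ω) = 1, q_{(124)}(ω) ≠ 1, q_{(134)}(ω) ≠ 1 and q_{(124)}(ω) ≠ q_{(134)}(ω); (ii) q_{(124)}(ω) = 1, q_{(123)}(ω) ≠ 1, q_{(134)}(ω) ≠ 1 and q_{(123)}(ω) ≠ q_{(134)}(ω)^{-1}; (iii) q_{(134)}(ω) = 1, q_{(123)}(ω) ≠ 1, q_{(124)}(ω) ≠ 1 and q_{(123)}(ω) ≠ q_{(124)}(ω); (iv) q_{(123)}(ω), q_{(124)}(ω), q_{(134)}(ω) are all ≠ 1 and q_{(123)}(ω)·q_{(134)}(ω) = q_{(124)}(ω) (equivalently q_{(234)}(ω) = 1). Then there exists a permutation σ of {1,2,3,4} such that Ω(ω) = V(x_{σ(1)}) ∪ V(x_{σ(2)}, x_{σ(3)}) ∪ V(x_{σ(2)}, x_{σ(4)}) ∪ V(x_{σ(3)}, x_{σ(4)}); i.e., the point variety of S^4_ω is the union of one hyperplane and three lines in ℙ^3. -/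

import Mathlib

/-- The cyclic `q`-number of a 3-cycle `(i j k)`: `q_{(ijk)}(ω) = ω_{ij} ω_{jk} ω_{ki}`. -/
def q3 (ω : Fin 4 → Fin 4 → ℂ) (i j k : Fin 4) : ℂ := ω i j * ω j k * ω k i

/-- The (affine cone, minus the origin, over the) point variety of `S^4_ω`:
`Ω(ω) = {x ≠ 0 : x_i x_j x_k = 0 for every triple i < j < k with q_{(ijk)}(ω) ≠ 1}`. -/
def Omega (ω : Fin 4 → Fin 4 → ℂ) : Set (Fin 4 → ℂ) :=
  {x | x ≠ 0 ∧ ∀ i j k : Fin 4, i < j → j < k → q3 ω i j k ≠ 1 →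
    x i * x j * x k = 0}

/-- The hyperplane `V(x_a)` (minus the origin). -/
def Vh (a : Fin 4) : Set (Fin 4 → ℂ) := {x | x ≠ 0 ∧ x a = 0}

/-- The line `V(x_a, x_b)` (minus the origin). -/
def Vl (a b : Fin 4) : Set (Fin 4 → ℂ) := {x | x ≠ 0 ∧ x a = 0 ∧ x b = 0}

/-- The `q`-numbers of the four triples of indices satisfy a single multiplicative relation. -/
theorem q3_mul_q3 (ω : Fin 4 → Fin 4 → ℂ) (hω1 : ∀ i j, ω i j * ω j i = 1) :
    q3 ω 0 1 2 * q3 ω 0 2 3 = q3 ω 0 1 3 * q3 ω 1 2 3 := by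
  simp only [q3]
  linear_combination
    (ω 0 1 * ω 1 2 * ω 2 3 * ω 3 0) * (hω1 0 2) - (ω 0 1 * ω 1 2 * ω 2 3 * ω 3 0) * (hω1 1 3)

/-- Membership in `Omega ω`, with the four increasing triples listed explicitly. -/
theorem mem_Omega_iff (ω : Fin 4 → Fin 4 → ℂ) (x : Fin 4 → ℂ) :
    x ∈ Omega ω ↔ x ≠ 0 ∧
      (q3 ω 0 1 2 ≠ 1 → x 0 * x 1 * x 2 = 0) ∧ (q3 ω 0 1 3 ≠ 1 → x 0 * x 1 * x 3 = 0) ∧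
      (q3 ω 0 2 3 ≠ 1 → x 0 * x 2 * x 3 = 0) ∧ (q3 ω 1 2 3 ≠ 1 → x 1 * x 2 * x 3 = 0) := by
  refine and_congr_right fun _ => ⟨fun h => ⟨h 0 1 2 (by decide) (by decide),
    h 0 1 3 (by decide) (by decide), h 0 2 3 (by decide) (by decide),
    h 1 2 3 (by decide) (by decide)⟩, ?_⟩
  rintro ⟨h₁, h₂, h₃, h₄⟩ i j k hij hjk
  fin_cases i <;> fin_cases j <;> first | exact absurd hij (by decide) | skip
  all_goals fin_cases k <;> first | exact absurd hjk (by decide) | assumption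

/-- Case 3 of the classification of point varieties of `S^4_ω`: under the listed
conditions on the cyclic `q`-numbers (indices `1,2,3,4` are `0,1,2,3`), the point
variety is a union of one hyperplane and three lines:
`V(x_{σ(1)}) ∪ V(x_{σ(2)}, x_{σ(3)}) ∪ V(x_{σ(2)}, x_{σ(4)}) ∪ V(x_{σ(3)}, x_{σ(4)})`
for some permutation `σ`. -/
theorem omega_eq_one_plane_three_lines (ω : Fin 4 → Fin 4 → ℂ)
    (hω0 : ∀ i j, ω i j ≠ 0) (hω1 : ∀ i j, ω i j * ω j i = 1)
    (h : (q3 ω 0 1 2 = 1 ∧ q3 ω 0 1 3 ≠ 1 ∧ q3 ω 0 2 3 ≠ 1 ∧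
            q3 ω 0 1 3 ≠ q3 ω 0 2 3) ∨
         (q3 ω 0 1 3 = 1 ∧ q3 ω 0 1 2 ≠ 1 ∧ q3 ω 0 2 3 ≠ 1 ∧
            q3 ω 0 1 2 ≠ (q3 ω 0 2 3)⁻¹) ∨
         (q3 ω 0 2 3 = 1 ∧ q3 ω 0 1 2 ≠ 1 ∧ q3 ω 0 1 3 ≠ 1 ∧
            q3 ω 0 1 2 ≠ q3 ω 0 1 3) ∨
         (q3 ω 0 1 2 ≠ 1 ∧ q3 ω 0 1 3 ≠ 1 ∧ q3 ω 0 2 3 ≠ 1 ∧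
            q3 ω 0 1 2 * q3 ω 0 2 3 = q3 ω 0 1 3)) :
    ∃ σ : Equiv.Perm (Fin 4),
      Omega ω = Vh (σ 0) ∪ Vl (σ 1) (σ 2) ∪ Vl (σ 1) (σ 3) ∪ Vl (σ 2) (σ 3) := by
  have hq := q3_mul_q3 ω hω1
  have h₀₁₃ : q3 ω 0 1 3 ≠ 0 := mul_ne_zero (mul_ne_zero (hω0 _ _) (hω0 _ _)) (hω0 _ _)
  rcases h with ⟨h₁, h₂, h₃, h₄⟩ | ⟨h₁, h₂, h₃, h₄⟩ | ⟨h₁, h₂, h₃, h₄⟩ | ⟨h₁, h₂, h₃, h₄⟩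
  · have h₅ : q3 ω 1 2 3 ≠ 1 := fun h => h₄ (by simpa [h₁, h] using hq.symm)
    refine ⟨Equiv.swap 0 3, Set.ext fun x => ?_⟩
    simp [mem_Omega_iff, Vh, Vl, Equiv.swap_apply_def, h₁, h₂, h₃, h₅]
    grind
  · have h₅ : q3 ω 1 2 3 ≠ 1 := fun h => h₄ (eq_inv_of_mul_eq_one_left (by simpa [h₁, h] using hq))
    refine ⟨Equiv.swap 0 2, Set.ext fun x => ?_⟩
    simp [mem_Omega_iff, Vh, Vl, Equiv.swap_apply_def, h₁, h₂, h₃, h₅]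
    grind
  · have h₅ : q3 ω 1 2 3 ≠ 1 := fun h => h₄ (by simpa [h₁, h] using hq)
    refine ⟨Equiv.swap 0 1, Set.ext fun x => ?_⟩
    simp [mem_Omega_iff, Vh, Vl, Equiv.swap_apply_def, h₁, h₂, h₃, h₅]
    grind
  · have h₅ : q3 ω 1 2 3 = 1 := mul_left_cancel₀ h₀₁₃ (by rw [← hq, h₄, mul_one])
    refine ⟨1, Set.ext fun x => ?_⟩
    simp [mem_Omega_iff, Vh, Vl, h₁, h₂, h₃, h₅]
    grind
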